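/- arXiv:2408.15456 — 3 statements merged into one kernel-verified Lean document; each statement's English description precedes it below -/
import Mathlib

section
/- Fix real numbers a, q, r with q > 0, r > 0, and an integer κ ≥ 1. Define J(k₁,k₂) := -(q + r⟨k₂,k₁⟩²)/(2(a + ⟨k₂,k₁⟩)) and f(k₁,k₂) := -(r⟨k₂,k₁⟩² + 2ar⟨k₂,k₁⟩ - q)/(2(a + ⟨k₂,k₁⟩)²) on 𝒦 := {(k₁,k₂) ∈ ℝ^κ × ℝ^κ : a + ⟨k₂,k₁⟩ < 0}. Let k₁, k₂ : [0,T) → ℝ^κ be differentiable with (k₁(t),k₂(t)) ∈ 𝒦, satisfying k₁' = -f(k₁,k₂)·k₂ and k₂' = -f(k₁,k₂)·k₁. Then: (i) the matrix C(t) := k₁(t)k₁(t)ᵀ - k₂(t)k₂(t)ᵀ is constant in t; and (ii) for all t, (d/dt)J(k₁(t),k₂(t)) = -f(k₁(t),k₂(t))²·(‖k₁(t)‖² + ‖k₂(t)‖²) = -f(k₁(t),k₂(t))²·√(c + 4⟨k₂(t),k₁(t)⟩²), where c := 2·trace(C(0)²) - (trace C(0))² is the level of imbalance of the initialization. -/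
open Matrix Set
open scoped RealInnerProductSpace

/-- A function whose derivative within a convex set of reals vanishes is constant on that set. -/
theorem Convex.eq_of_hasDerivWithinAt_zero {E : Type*} [NormedAddCommGroup E] [NormedSpace ℝ E]
    {g : ℝ → E} {s : Set ℝ} (hs : Convex ℝ s) (hg : ∀ t ∈ s, HasDerivWithinAt g 0 s t)
    {x y : ℝ} (hx : x ∈ s) (hy : y ∈ s) : g y = g x := by
  have h := hs.norm_image_sub_le_of_norm_hasDerivWithin_le (C := 0) hg (by simp) hx hy
  simpa [sub_eq_zero] using h

theorem HasDerivWithinAt.euclideanSpace_apply {ι : Type*} [Fintype ι]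
    {g : ℝ → EuclideanSpace ℝ ι} {g' : EuclideanSpace ℝ ι} {s : Set ℝ} {t : ℝ}
    (h : HasDerivWithinAt g g' s t) (i : ι) : HasDerivWithinAt (fun u => g u i) (g' i) s t :=
  ((EuclideanSpace.proj i : EuclideanSpace ℝ ι →L[ℝ] ℝ).hasFDerivAt.comp_hasDerivWithinAt t h)

/-- The flow `x' = φ y`, `y' = φ x` conserves the entries of `xxᵀ - yyᵀ`. -/
theorem hasDerivWithinAt_imbalance {ι : Type*} [Fintype ι] {x y : ℝ → EuclideanSpace ℝ ι}
    {s : Set ℝ} {t φ : ℝ} (hx : HasDerivWithinAt x (φ • y t) s t)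
    (hy : HasDerivWithinAt y (φ • x t) s t) (i j : ι) :
    HasDerivWithinAt (fun u => x u i * x u j - y u i * y u j) 0 s t := by
  have h := ((hx.euclideanSpace_apply i).mul (hx.euclideanSpace_apply j)).sub
    ((hy.euclideanSpace_apply i).mul (hy.euclideanSpace_apply j))
  refine h.congr_deriv ?_
  simp only [PiLp.smul_apply, smul_eq_mul]
  ring

theorem hasDerivWithinAt_inner_of_flow {E : Type*} [NormedAddCommGroup E] [InnerProductSpace ℝ E]
    {x y : ℝ → E} {s : Set ℝ} {t φ : ℝ} (hx : HasDerivWithinAt x (φ • y t) s t)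
    (hy : HasDerivWithinAt y (φ • x t) s t) :
    HasDerivWithinAt (fun u => ⟪y u, x u⟫) (φ * (‖x t‖ ^ 2 + ‖y t‖ ^ 2)) s t := by
  refine (hy.inner ℝ hx).congr_deriv ?_
  simp only [real_inner_smul_left, real_inner_smul_right, real_inner_self_eq_norm_sq]
  ring

/-- The derivative of the scalar cost `z ↦ -(q + r z²) / (2 (a + z))`. -/
theorem hasDerivAt_scalar_cost (a q r : ℝ) {z : ℝ} (hz : a + z ≠ 0) :
    HasDerivAt (fun z => -(q + r * z ^ 2) / (2 * (a + z)))
      (-(r * z ^ 2 + 2 * a * r * z - q) / (2 * (a + z) ^ 2)) z := by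
  have hnum : HasDerivAt (fun z : ℝ => -(q + r * z ^ 2)) (-(r * (2 * z))) z := by
    exact ((((hasDerivAt_pow 2 z).const_mul r).const_add q).neg).congr_deriv (by simp)
  have hden : HasDerivAt (fun z : ℝ => 2 * (a + z)) 2 z := by
    simpa using ((hasDerivAt_id z).const_add a).const_mul 2
  refine (hnum.div hden (mul_ne_zero two_ne_zero hz)).congr_deriv ?_
  field_simp
  ring

theorem trace_vecMulVec_self_sub_vecMulVec_self {ι : Type*} [Fintype ι] (x y : EuclideanSpace ℝ ι) :
    (Matrix.of fun i j => x i * x j - y i * y j).trace = ‖x‖ ^ 2 - ‖y‖ ^ 2 := by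
  simp only [Matrix.trace, Matrix.diag_apply, Matrix.of_apply, EuclideanSpace.real_norm_sq_eq,
    Finset.sum_sub_distrib, ← pow_two]

theorem trace_sq_vecMulVec_self_sub_vecMulVec_self {ι : Type*} [Fintype ι]
    (x y : EuclideanSpace ℝ ι) :
    ((Matrix.of fun i j => x i * x j - y i * y j) *
      (Matrix.of fun i j => x i * x j - y i * y j)).trace
      = (‖x‖ ^ 2) ^ 2 + (‖y‖ ^ 2) ^ 2 - 2 * ⟪y, x⟫ ^ 2 := by
  have hin : ⟪y, x⟫ = ∑ i, x i * y i := by simp [PiLp.inner_apply]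
  simp only [Matrix.trace, Matrix.diag_apply, Matrix.mul_apply, Matrix.of_apply,
    EuclideanSpace.real_norm_sq_eq, hin]
  simp only [pow_two (∑ i, _), Finset.sum_mul_sum]
  simp only [Finset.mul_sum, ← Finset.sum_add_distrib, ← Finset.sum_sub_distrib]
  refine Finset.sum_congr rfl fun i _ => Finset.sum_congr rfl fun j _ => ?_
  ring

/-- The level of imbalance in terms of the norms and the inner product. -/
theorem sq_norm_sq_add_norm_sq {ι : Type*} [Fintype ι] (x y : EuclideanSpace ℝ ι)
    {C : Matrix ι ι ℝ} (hC : C = Matrix.of fun i j => x i * x j - y i * y j) :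
    2 * (C * C).trace - C.trace ^ 2 + 4 * ⟪y, x⟫ ^ 2 = (‖x‖ ^ 2 + ‖y‖ ^ 2) ^ 2 := by
  rw [hC, trace_vecMulVec_self_sub_vecMulVec_self, trace_sq_vecMulVec_self_sub_vecMulVec_self]
  ring

/-- **Conservation law and cost decay rate for the vector-case gradient flow.**
Along any solution of `k₁' = -f·k₂`, `k₂' = -f·k₁` on `[0,T)` staying in the stabilizing set:
(i) `C(t) = k₁(t)k₁(t)ᵀ - k₂(t)k₂(t)ᵀ` is constant;
(ii) `dJ/dt = -f²(‖k₁‖² + ‖k₂‖²) = -f²√(c + 4⟪k₂,k₁⟫²)`, where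
`c = 2 trace(C(0)²) - (trace C(0))²` is the level of imbalance. -/
theorem vector_case_cost_decay (a q r : ℝ) (hq : 0 < q) (hr : 0 < r)
    (κ : ℕ) (hκ : 1 ≤ κ)
    (J f : EuclideanSpace ℝ (Fin κ) → EuclideanSpace ℝ (Fin κ) → ℝ)
    (hJ : ∀ k₁ k₂, J k₁ k₂ = -(q + r * ⟪k₂, k₁⟫ ^ 2) / (2 * (a + ⟪k₂, k₁⟫)))
    (hf : ∀ k₁ k₂, f k₁ k₂
      = -(r * ⟪k₂, k₁⟫ ^ 2 + 2 * a * r * ⟪k₂, k₁⟫ - q) / (2 * (a + ⟪k₂, k₁⟫) ^ 2))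
    (T : ℝ) (hT : 0 < T)
    (k₁ k₂ : ℝ → EuclideanSpace ℝ (Fin κ))
    (hstab : ∀ t ∈ Ico (0 : ℝ) T, a + ⟪k₂ t, k₁ t⟫ < 0)
    (hflow₁ : ∀ t ∈ Ico (0 : ℝ) T,
      HasDerivWithinAt k₁ (-(f (k₁ t) (k₂ t)) • k₂ t) (Ico 0 T) t)
    (hflow₂ : ∀ t ∈ Ico (0 : ℝ) T,
      HasDerivWithinAt k₂ (-(f (k₁ t) (k₂ t)) • k₁ t) (Ico 0 T) t)
    (C : ℝ → Matrix (Fin κ) (Fin κ) ℝ)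
    (hC : ∀ t, C t = Matrix.of fun i j => k₁ t i * k₁ t j - k₂ t i * k₂ t j)
    (c : ℝ) (hc : c = 2 * (C 0 * C 0).trace - (C 0).trace ^ 2) :
    (∀ t ∈ Ico (0 : ℝ) T, C t = C 0) ∧
    (∀ t ∈ Ico (0 : ℝ) T,
      HasDerivWithinAt (fun s => J (k₁ s) (k₂ s))
        (-(f (k₁ t) (k₂ t)) ^ 2 * (‖k₁ t‖ ^ 2 + ‖k₂ t‖ ^ 2)) (Ico 0 T) t ∧
      -(f (k₁ t) (k₂ t)) ^ 2 * (‖k₁ t‖ ^ 2 + ‖k₂ t‖ ^ 2)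
        = -(f (k₁ t) (k₂ t)) ^ 2 * Real.sqrt (c + 4 * ⟪k₂ t, k₁ t⟫ ^ 2)) := by
  have hconst : ∀ t ∈ Ico (0 : ℝ) T, C t = C 0 := by
    intro t ht
    ext i j
    simp only [hC, Matrix.of_apply]
    exact (convex_Ico (0 : ℝ) T).eq_of_hasDerivWithinAt_zero
      (fun u hu => hasDerivWithinAt_imbalance (hflow₁ u hu) (hflow₂ u hu) i j)
      (left_mem_Ico.2 hT) ht
  refine ⟨hconst, fun t ht => ⟨?_, ?_⟩⟩
  · simp only [hJ]
    refine ((hasDerivAt_scalar_cost a q r (hstab t ht).ne).comp_hasDerivWithinAt t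
      (hasDerivWithinAt_inner_of_flow (hflow₁ t ht) (hflow₂ t ht))).congr_deriv ?_
    rw [← hf]
    ring
  · rw [hc, ← hconst t ht, sq_norm_sq_add_norm_sq _ _ (hC t), Real.sqrt_sq (by positivity)]
end

section
/- Fix real numbers a, q, r with q > 0, r > 0, and an integer κ ≥ 1. Define f̂(s) := -(r·s² + 2ar·s - q)/(2(a + s)²), the stabilizing set 𝒦 := {(k₁,k₂) ∈ ℝ^κ × ℝ^κ : a + ⟨k₂,k₁⟩ < 0}, k₋* := -a - √(a² + q/r), and a₊ := max(a,0). Let α be a real number with 2√(a₊) < α < 2√(|k₋*|). Let k₁, k₂ : [0,T) → ℝ^κ be differentiable curves remaining in 𝒦 and satisfying the disturbed gradient-flow dynamics k₁'(t) = -f̂(⟨k₂(t),k₁(t)⟩)·k₂(t) + u₁(t) and k₂'(t) = -f̂(⟨k₂(t),k₁(t)⟩)·k₁(t) + u₂(t), where the disturbances satisfy sup_{t ∈ [0,T)} ‖u₁(t) - u₂(t)‖ ≤ α·f̂(-α²/4). If ‖k₁(0) - k₂(0)‖² ≥ α², then ‖k₁(t) - k₂(t)‖² ≥ α² for all t ∈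 [0,T); that is, the set ℛ_α := {(k₁,k₂) ∈ 𝒦 : ‖k₁ - k₂‖² ≥ α²} is forward-invariant under the disturbed flow. -/
open Set
open scoped RealInnerProductSpace

/-- A function that starts nonpositive and satisfies `f' ≤ L f` wherever it is positive stays
nonpositive. -/
theorem nonpos_of_deriv_right_le_mul_of_pos {f f' : ℝ → ℝ} {L a b : ℝ}
    (hf : ContinuousOn f (Icc a b))
    (hf' : ∀ x ∈ Ico a b, HasDerivWithinAt f (f' x) (Ici x) x)
    (ha : f a ≤ 0) (bound : ∀ x ∈ Ico a b, 0 < f x → f' x ≤ L * f x) :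
    ∀ x ∈ Icc a b, f x ≤ 0 := by
  intro x hx
  have key : ∀ ε > 0, f x ≤ ε * Real.exp ((L + 1) * x) := by
    intro ε hε
    have hB : ∀ y, HasDerivAt (fun y => ε * Real.exp ((L + 1) * y))
        (ε * (Real.exp ((L + 1) * y) * (L + 1))) y := fun y => by
      simpa using ((((hasDerivAt_id y).const_mul (L + 1)).exp).const_mul ε)
    refine image_le_of_deriv_right_lt_deriv_boundary hf hf'
      (ha.trans (by positivity)) hB (fun y hy hfy => ?_) hx
    have hpos : 0 < ε * Real.exp ((L + 1) * y) := by positivity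
    have h := bound y hy (hfy ▸ hpos)
    rw [hfy] at h
    linarith
  refine le_of_forall_pos_le_add fun δ hδ => ?_
  have h := key (δ / Real.exp ((L + 1) * x)) (by positivity)
  rwa [div_mul_cancel₀ _ (Real.exp_pos _).ne', ← zero_add δ] at h

/-- The LQR gradient factor is nondecreasing on the stabilizing half-line `a + s < 0`. -/
theorem lqr_gradient_factor_mono {a q r s t : ℝ} (hq : 0 ≤ q) (hr : 0 ≤ r) (hst : s ≤ t)
    (ht : a + t < 0) :
    -(r * s ^ 2 + 2 * a * r * s - q) / (2 * (a + s) ^ 2) ≤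
      -(r * t ^ 2 + 2 * a * r * t - q) / (2 * (a + t) ^ 2) := by
  have rewrite_factor : ∀ x, a + x < 0 → -(r * x ^ 2 + 2 * a * r * x - q) / (2 * (a + x) ^ 2) =
      (q + r * a ^ 2) / (2 * (a + x) ^ 2) - r / 2 := by
    intro x hx
    have := hx.ne
    field_simp
    ring
  rw [rewrite_factor s (by linarith), rewrite_factor t ht]
  have h1 : 0 < (a + t) ^ 2 := by nlinarith
  have h2 : (a + t) ^ 2 ≤ (a + s) ^ 2 := by nlinarith
  gcongr

theorem neg_norm_sub_sq_div_four_le_inner {E : Type*} [NormedAddCommGroup E]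
    [InnerProductSpace ℝ E] (x y : E) : -‖x - y‖ ^ 2 / 4 ≤ ⟪y, x⟫ := by
  have h1 := norm_sub_sq_real x y
  have h2 := norm_add_sq_real x y
  rw [real_inner_comm]
  nlinarith [sq_nonneg ‖x + y‖]

/-- **Forward invariance of the imbalanced region under disturbed gradient flow.**
With `f̂(s) = -(rs² + 2ars - q)/(2(a+s)²)`, `k₋* = -a - √(a² + q/r)`, `a₊ = max(a,0)` and
`2√(a₊) < α < 2√|k₋*|`, any solution of the disturbed flow
`k₁' = -f̂(⟪k₂,k₁⟫)k₂ + u₁`, `k₂' = -f̂(⟪k₂,k₁⟫)k₁ + u₂` remaining in the stabilizing set,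
with `‖u₁ - u₂‖ ≤ α f̂(-α²/4)` and `‖k₁(0)-k₂(0)‖² ≥ α²`, satisfies
`‖k₁(t)-k₂(t)‖² ≥ α²` for all `t ∈ [0,T)`. -/
theorem disturbed_flow_region_invariance (a q r : ℝ) (hq : 0 < q) (hr : 0 < r)
    (κ : ℕ) (hκ : 1 ≤ κ)
    (fhat : ℝ → ℝ)
    (hfhat : ∀ s, fhat s = -(r * s ^ 2 + 2 * a * r * s - q) / (2 * (a + s) ^ 2))
    (kstar : ℝ) (hkstar : kstar = -a - Real.sqrt (a ^ 2 + q / r))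
    (α : ℝ) (hα₁ : 2 * Real.sqrt (max a 0) < α) (hα₂ : α < 2 * Real.sqrt |kstar|)
    (T : ℝ) (hT : 0 < T)
    (k₁ k₂ u₁ u₂ : ℝ → EuclideanSpace ℝ (Fin κ))
    (hstab : ∀ t ∈ Ico (0 : ℝ) T, a + ⟪k₂ t, k₁ t⟫ < 0)
    (hflow₁ : ∀ t ∈ Ico (0 : ℝ) T,
      HasDerivWithinAt k₁ (-(fhat ⟪k₂ t, k₁ t⟫) • k₂ t + u₁ t) (Ico 0 T) t)
    (hflow₂ : ∀ t ∈ Ico (0 : ℝ) T,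
      HasDerivWithinAt k₂ (-(fhat ⟪k₂ t, k₁ t⟫) • k₁ t + u₂ t) (Ico 0 T) t)
    (hdist : ∀ t ∈ Ico (0 : ℝ) T, ‖u₁ t - u₂ t‖ ≤ α * fhat (-α ^ 2 / 4))
    (hinit : ‖k₁ 0 - k₂ 0‖ ^ 2 ≥ α ^ 2) :
    ∀ t ∈ Ico (0 : ℝ) T, ‖k₁ t - k₂ t‖ ^ 2 ≥ α ^ 2 := by
  have hα : 0 < α := lt_of_le_of_lt (by positivity) hα₁
  have haα : a + -α ^ 2 / 4 < 0 := by
    have h := Real.sq_sqrt (le_max_right a 0)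
    nlinarith [Real.sqrt_nonneg (max a 0), le_max_left a 0]
  set c := fhat (-α ^ 2 / 4) with hc
  have hc0 : 0 ≤ c := by
    have h := (norm_nonneg _).trans (hdist 0 ⟨le_rfl, hT⟩)
    exact nonneg_of_mul_nonneg_right h hα
  set v' : ℝ → EuclideanSpace ℝ (Fin κ) := fun t =>
    (-(fhat ⟪k₂ t, k₁ t⟫) • k₂ t + u₁ t) - (-(fhat ⟪k₂ t, k₁ t⟫) • k₁ t + u₂ t) with hv'
  have hW : ∀ t ∈ Ico (0 : ℝ) T, HasDerivWithinAt (fun t => α ^ 2 - ‖k₁ t - k₂ t‖ ^ 2)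
      (-(2 * ⟪k₁ t - k₂ t, v' t⟫)) (Ico 0 T) t := fun t ht =>
    (((hflow₁ t ht).sub (hflow₂ t ht)).norm_sq).const_sub _
  intro t ht
  have hsub : Icc 0 t ⊆ Ico 0 T := fun x hx => ⟨hx.1, hx.2.trans_lt ht.2⟩
  suffices h : α ^ 2 - ‖k₁ t - k₂ t‖ ^ 2 ≤ 0 by linarith
  refine nonpos_of_deriv_right_le_mul_of_pos (L := 2 * c)
    (f := fun t => α ^ 2 - ‖k₁ t - k₂ t‖ ^ 2)
    (fun x hx => ((hW x (hsub hx)).continuousWithinAt).mono hsub)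
    (fun x hx => (hW x (hsub (Ico_subset_Icc_self hx))).mono_of_mem_nhdsWithin ?_)
    (by linarith) ?_ t ⟨ht.1, le_rfl⟩
  · exact Filter.mem_of_superset (Ico_mem_nhdsGE (hx.2.trans ht.2))
      (Ico_subset_Ico_left hx.1)
  · intro x hx hpos
    have hxT := hsub (Ico_subset_Icc_self hx)
    have hs := neg_norm_sub_sq_div_four_le_inner (k₁ x) (k₂ x)
    have hcf : c ≤ fhat ⟪k₂ x, k₁ x⟫ := by
      rw [hc, hfhat, hfhat]
      exact lqr_gradient_factor_mono hq.le hr.le (by linarith) (hstab x hxT)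
    have hinner : ⟪k₁ x - k₂ x, v' x⟫ =
        fhat ⟪k₂ x, k₁ x⟫ * ‖k₁ x - k₂ x‖ ^ 2 + ⟪k₁ x - k₂ x, u₁ x - u₂ x⟫ := by
      rw [← real_inner_self_eq_norm_sq, ← real_inner_smul_right, ← inner_add_right]
      congr 1
      simp only [hv']
      module
    have hcs := neg_le_of_abs_le (abs_real_inner_le_norm (k₁ x - k₂ x) (u₁ x - u₂ x))
    have hn := norm_nonneg (k₁ x - k₂ x)
    have hlt : ‖k₁ x - k₂ x‖ ≤ α := by nlinarith
    have hd := mul_le_mul_of_nonneg_left (hdist x hxT) hn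
    have hg := mul_le_mul_of_nonneg_right hcf (sq_nonneg ‖k₁ x - k₂ x‖)
    have hlast := mul_nonneg (mul_nonneg hc0 hα.le) (sub_nonneg.2 hlt)
    rw [hinner]
    nlinarith
end

section
/- Fix real numbers a, q, r with q > 0, r > 0, and an integer κ ≥ 1. Define J(k₁,k₂) := -(q + r⟨k₂,k₁⟩²)/(2(a + ⟨k₂,k₁⟩)) and f̂(s) := -(r·s² + 2ar·s - q)/(2(a + s)²) on the stabilizing set 𝒦 := {(k₁,k₂) ∈ ℝ^κ × ℝ^κ : a + ⟨k₂,k₁⟩ < 0}, let J* := a·r + r·√(a² + q/r) (the optimal LQR cost), and let a₊ := max(a,0). Fix an initial condition (k₁⁰,k₂⁰) ∈ 𝒦 with ‖k₁⁰ - k₂⁰‖ > 2√(a₊). Then for every ε > 0 there exists δ > 0 such that: for every pair of bounded disturbances u₁, u₂ : [0,∞) → ℝ^κ with sup_t‖u₁(t)‖ + sup_t‖u₂(t)‖ ≤ δ and every differentiable solution k₁, k₂ : [0,∞) → ℝ^κ of the disturbed dynamics k₁'(t) = -f̂(⟨k₂(t),k₁(t)⟩)·k₂(t) + u₁(t), k₂'(t)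 = -f̂(⟨k₂(t),k₁(t)⟩)·k₁(t) + u₂(t) with (k₁(0),k₂(0)) = (k₁⁰,k₂⁰) that remains in 𝒦 for all t ≥ 0, one has limsup_{t→∞} (J(k₁(t),k₂(t)) - J*) ≤ ε. -/
open Set Filter
open scoped RealInnerProductSpace

/-- A constant level that `g` can only cross with negative derivative is a barrier for `g`. -/
theorem le_of_deriv_neg_of_eq {g g' : ℝ → ℝ} {t₀ L : ℝ} (h0 : g t₀ ≤ L)
    (hg : ∀ t, t₀ ≤ t → HasDerivWithinAt g (g' t) (Ici t₀) t)
    (hneg : ∀ t, t₀ ≤ t → g t = L → g' t < 0) {t : ℝ} (ht : t₀ ≤ t) : g t ≤ L := by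
  refine image_le_of_deriv_right_lt_deriv_boundary' (f := g) (f' := g') (a := t₀) (b := t)
    (B := fun _ => L) (B' := fun _ => 0) ?_ ?_ h0 continuousOn_const
    (fun x _ => hasDerivWithinAt_const _ _ _) (fun x hx h => hneg x hx.1 h) ⟨ht, le_rfl⟩
  · exact fun x hx => (hg x hx.1).continuousWithinAt.mono Icc_subset_Ici_self
  · exact fun x hx => (hg x hx.1).mono (Ici_subset_Ici.2 hx.1)

/-- If `g` decreases at a uniform rate whenever it is at least `L`, it is eventually at most `L`. -/
theorem eventually_le_of_deriv_le_neg {g g' : ℝ → ℝ} {L μ : ℝ} (hμ : 0 < μ)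
    (hg : ∀ t, 0 ≤ t → HasDerivWithinAt g (g' t) (Ici 0) t)
    (hneg : ∀ t, 0 ≤ t → L ≤ g t → g' t ≤ -μ) : ∀ᶠ t in atTop, g t ≤ L := by
  obtain ⟨t₀, ht₀, h₀⟩ : ∃ t₀, 0 ≤ t₀ ∧ g t₀ ≤ L := by
    by_contra! hcon
    have hdecay : ∀ t, 0 ≤ t → g t + μ / 2 * t ≤ g 0 := fun t ht =>
      le_of_deriv_neg_of_eq (g := fun t => g t + μ / 2 * t) (g' := fun t => g' t + μ / 2)
        (by simp)
        (fun s hs => (hg s hs).add (by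
          simpa using ((hasDerivAt_id s).const_mul (μ / 2)).hasDerivWithinAt))
        (fun s hs _ => by linarith [hneg s hs (hcon s hs).le]) ht
    have hT : 0 ≤ (g 0 - L) / (μ / 2) := div_nonneg (by linarith [hcon 0 le_rfl]) (by positivity)
    have h1 := hdecay _ hT
    have h2 := hcon _ hT
    rw [mul_div_cancel₀ _ (by positivity : μ / 2 ≠ 0)] at h1
    linarith
  filter_upwards [eventually_ge_atTop t₀] with t ht
  exact le_of_deriv_neg_of_eq h₀
    (fun s hs => (hg s (ht₀.trans hs)).mono (Ici_subset_Ici.2 ht₀))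
    (fun s hs h => by linarith [hneg s (ht₀.trans hs) h.ge]) ht

/-- The quantity `r / 2 * (X ^ 2 / x ^ 2 - 1)` is antitone in `x > 0`. -/
theorem lqr_rate_antitone {r X x y : ℝ} (hr : 0 < r) (hx : 0 < x) (hxy : x ≤ y) :
    r / 2 * (X ^ 2 / y ^ 2 - 1) ≤ r / 2 * (X ^ 2 / x ^ 2 - 1) := by
  gcongr

theorem lqr_rate_pos {r X x : ℝ} (hr : 0 < r) (hx : 0 < x) (hxX : x < X) :
    0 < r / 2 * (X ^ 2 / x ^ 2 - 1) := by
  have : 1 < X ^ 2 / x ^ 2 := by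
    rw [one_lt_div (by positivity)]
    gcongr
  exact mul_pos (by positivity) (by linarith)

theorem lqr_rate_neg {r X x : ℝ} (hr : 0 < r) (hX : 0 < X) (hxX : X < x) :
    r / 2 * (X ^ 2 / x ^ 2 - 1) < 0 := by
  have hx : 0 < x := hX.trans hxX
  have : X ^ 2 / x ^ 2 < 1 := by
    rw [div_lt_one (by positivity)]
    gcongr
  exact mul_neg_of_pos_of_neg (by positivity) (by linarith)

section

variable {E : Type*} [NormedAddCommGroup E] [InnerProductSpace ℝ E]

/-- The inner product is controlled from below by the difference of the two vectors. -/
theorem neg_inner_le_norm_sub_sq_div_four (v w : E) : -⟪w, v⟫ ≤ ‖v - w‖ ^ 2 / 4 := by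
  have h1 := norm_sub_sq_real v w
  have h2 := norm_add_sq_real v w
  rw [real_inner_comm w v] at *
  nlinarith [sq_nonneg ‖v + w‖]

/-- When the two gains are at distance at least `c`, the disturbance part of the derivative of the
loop gain is dominated by the squared norm of the gains. -/
theorem abs_disturbance_le {c δ M₁ M₂ : ℝ} (hc : 0 < c) {v w u₁ u₂ : E}
    (h₁ : ‖u₁‖ ≤ M₁) (h₂ : ‖u₂‖ ≤ M₂) (hM : M₁ + M₂ ≤ δ) (hd : c ≤ ‖v - w‖) :
    |⟪w, u₁⟫ + ⟪u₂, v⟫| ≤ 2 * δ / c * (‖v‖ ^ 2 + ‖w‖ ^ 2) := by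
  have n1 := norm_nonneg u₁
  have n2 := norm_nonneg u₂
  have nv := norm_nonneg v
  have nw := norm_nonneg w
  have hS : c ≤ ‖v‖ + ‖w‖ := hd.trans (norm_sub_le v w)
  have hδ : 0 ≤ δ := by linarith
  have e1 : |⟪w, u₁⟫| ≤ ‖w‖ * δ :=
    (abs_real_inner_le_norm w u₁).trans (by gcongr; linarith)
  have e2 : |⟪u₂, v⟫| ≤ δ * ‖v‖ :=
    (abs_real_inner_le_norm u₂ v).trans (by gcongr; linarith)
  have key : c * (‖v‖ + ‖w‖) ≤ 2 * (‖v‖ ^ 2 + ‖w‖ ^ 2) := by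
    nlinarith [sq_nonneg (‖v‖ - ‖w‖)]
  calc |⟪w, u₁⟫ + ⟪u₂, v⟫| ≤ δ * (‖v‖ + ‖w‖) := by linarith [abs_add_le ⟪w, u₁⟫ ⟪u₂, v⟫]
    _ = δ / c * (c * (‖v‖ + ‖w‖)) := by field_simp
    _ ≤ δ / c * (2 * (‖v‖ ^ 2 + ‖w‖ ^ 2)) := by gcongr
    _ = _ := by ring

variable {F : ℝ → ℝ} {k₁ k₂ u₁ u₂ : ℝ → E} {c δ M₁ M₂ : ℝ}

/-- If the rate `F` is uniformly positive whenever the gains are at distance `c`, then small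
disturbances cannot bring the gains closer to each other than `c`. -/
theorem le_norm_sub_of_disturbed_flow {η : ℝ} (hc : 0 < c) (hδ : δ < η * c)
    (h₁ : ∀ t, ‖u₁ t‖ ≤ M₁) (h₂ : ∀ t, ‖u₂ t‖ ≤ M₂) (hM : M₁ + M₂ ≤ δ)
    (hk₁ : ∀ t, 0 ≤ t → HasDerivWithinAt k₁ (-F t • k₂ t + u₁ t) (Ici 0) t)
    (hk₂ : ∀ t, 0 ≤ t → HasDerivWithinAt k₂ (-F t • k₁ t + u₂ t) (Ici 0) t)
    (h0 : c ≤ ‖k₁ 0 - k₂ 0‖) (hF : ∀ t, 0 ≤ t → ‖k₁ t - k₂ t‖ = c → η ≤ F t)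
    {t : ℝ} (ht : 0 ≤ t) : c ≤ ‖k₁ t - k₂ t‖ := by
  have key : -‖k₁ t - k₂ t‖ ^ 2 ≤ -c ^ 2 := by
    refine le_of_deriv_neg_of_eq (g := fun t => -‖k₁ t - k₂ t‖ ^ 2) (t₀ := 0)
      (by simpa using pow_le_pow_left₀ hc.le h0 2)
      (fun s hs => ((hk₁ s hs).sub (hk₂ s hs)).norm_sq.neg) (fun s hs h => ?_) ht
    have hd : ‖k₁ s - k₂ s‖ = c := by
      have : ‖k₁ s - k₂ s‖ ^ 2 = c ^ 2 := by simpa using h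
      exact (pow_left_inj₀ (norm_nonneg _) hc.le two_ne_zero).1 this
    have hv : (-F s • k₂ s + u₁ s) - (-F s • k₁ s + u₂ s)
        = F s • (k₁ s - k₂ s) + (u₁ s - u₂ s) := by module
    have hu : ‖u₁ s - u₂ s‖ ≤ δ := (norm_sub_le _ _).trans (by linarith [h₁ s, h₂ s])
    have hi := neg_le_of_abs_le (abs_real_inner_le_norm (k₁ s - k₂ s) (u₁ s - u₂ s))
    rw [Pi.sub_apply, hv, inner_add_right, real_inner_smul_right, real_inner_self_eq_norm_sq]
    rw [hd] at hi ⊢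
    have : η * c ^ 2 ≤ F s * c ^ 2 := by gcongr; exact hF s hs hd
    nlinarith [mul_le_mul_of_nonneg_left hu hc.le, mul_lt_mul_of_pos_left hδ hc]
  exact (pow_le_pow_iff_left₀ hc.le (norm_nonneg _) two_ne_zero).1 (neg_le_neg_iff.1 key)

/-- If the gains stay at distance at least `c`, the sign of the rate `F` off the interval
`[xl, xh]` drives `x = -a - ⟪k₂, k₁⟫` into that interval. -/
theorem eventually_mem_Icc_of_disturbed_flow {a m xl xh : ℝ} (hc : 0 < c) (hm : 0 < m)
    (hδ : δ ≤ m * c / 4)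
    (h₁ : ∀ t, ‖u₁ t‖ ≤ M₁) (h₂ : ∀ t, ‖u₂ t‖ ≤ M₂) (hM : M₁ + M₂ ≤ δ)
    (hk₁ : ∀ t, 0 ≤ t → HasDerivWithinAt k₁ (-F t • k₂ t + u₁ t) (Ici 0) t)
    (hk₂ : ∀ t, 0 ≤ t → HasDerivWithinAt k₂ (-F t • k₁ t + u₂ t) (Ici 0) t)
    (hd : ∀ t, 0 ≤ t → c ≤ ‖k₁ t - k₂ t‖)
    (hlo : ∀ t, 0 ≤ t → -a - ⟪k₂ t, k₁ t⟫ ≤ xl → m ≤ F t)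
    (hhi : ∀ t, 0 ≤ t → xh ≤ -a - ⟪k₂ t, k₁ t⟫ → F t ≤ -m) :
    ∀ᶠ t in atTop, -a - ⟪k₂ t, k₁ t⟫ ∈ Icc xl xh := by
  have hderiv : ∀ t, 0 ≤ t → HasDerivWithinAt (fun t => -a - ⟪k₂ t, k₁ t⟫)
      (F t * (‖k₁ t‖ ^ 2 + ‖k₂ t‖ ^ 2) - (⟪k₂ t, u₁ t⟫ + ⟪u₂ t, k₁ t⟫)) (Ici 0) t := by
    intro t ht
    refine (((hk₂ t ht).inner ℝ (hk₁ t ht)).const_sub (-a)).congr_deriv ?_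
    rw [inner_add_right, inner_add_left, real_inner_smul_right, real_inner_smul_left,
      real_inner_self_eq_norm_sq, real_inner_self_eq_norm_sq]
    ring
  have hN : ∀ t, 0 ≤ t → c ^ 2 / 2 ≤ ‖k₁ t‖ ^ 2 + ‖k₂ t‖ ^ 2 := by
    intro t ht
    have hS : c ≤ ‖k₁ t‖ + ‖k₂ t‖ := (hd t ht).trans (norm_sub_le _ _)
    nlinarith [sq_nonneg (‖k₁ t‖ - ‖k₂ t‖)]
  have he : ∀ t, 0 ≤ t → |⟪k₂ t, u₁ t⟫ + ⟪u₂ t, k₁ t⟫| ≤ m / 2 * (‖k₁ t‖ ^ 2 + ‖k₂ t‖ ^ 2) := by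
    intro t ht
    refine (abs_disturbance_le hc (h₁ t) (h₂ t) hM (hd t ht)).trans
      (mul_le_mul_of_nonneg_right ?_ (by positivity))
    rw [div_le_iff₀ hc]
    linarith
  have hμ : 0 < m / 2 * (c ^ 2 / 2) := by positivity
  have hup := eventually_le_of_deriv_le_neg (L := xh) hμ hderiv (fun t ht h => by
    have b1 := mul_le_mul_of_nonneg_right (hhi t ht h)
      (by positivity : 0 ≤ ‖k₁ t‖ ^ 2 + ‖k₂ t‖ ^ 2)
    have b2 := mul_le_mul_of_nonneg_left (hN t ht) (half_pos hm).le
    linarith [neg_le_of_abs_le (he t ht)])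
  have hdown := eventually_le_of_deriv_le_neg (L := -xl) hμ (fun t ht => (hderiv t ht).neg)
    (fun t ht h => by
      have b1 := mul_le_mul_of_nonneg_right (hlo t ht (neg_le_neg_iff.1 h))
        (by positivity : 0 ≤ ‖k₁ t‖ ^ 2 + ‖k₂ t‖ ^ 2)
      have b2 := mul_le_mul_of_nonneg_left (hN t ht) (half_pos hm).le
      linarith [le_of_abs_le (he t ht)])
  filter_upwards [hup, hdown] with t h1 h2
  exact ⟨neg_le_neg_iff.1 h2, h1⟩

end

/-- **Input-to-cost stability of the disturbed vector-case gradient flow.**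
Fix an initialization `(k₁⁰,k₂⁰)` in the stabilizing set with `‖k₁⁰-k₂⁰‖ > 2√(a₊)`.
For every `ε > 0` there is `δ > 0` such that for all disturbances with
`sup‖u₁‖ + sup‖u₂‖ ≤ δ` and every solution of the disturbed flow starting at `(k₁⁰,k₂⁰)`
and remaining in the stabilizing set, `limsup_{t→∞} (J(k₁(t),k₂(t)) - J*) ≤ ε`, where
`J* = ar + r√(a² + q/r)` is the optimal LQR cost. -/
theorem input_to_cost_stability (a q r : ℝ) (hq : 0 < q) (hr : 0 < r)
    (κ : ℕ) (hκ : 1 ≤ κ)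
    (J : EuclideanSpace ℝ (Fin κ) → EuclideanSpace ℝ (Fin κ) → ℝ)
    (hJ : ∀ k₁ k₂, J k₁ k₂ = -(q + r * ⟪k₂, k₁⟫ ^ 2) / (2 * (a + ⟪k₂, k₁⟫)))
    (fhat : ℝ → ℝ)
    (hfhat : ∀ s, fhat s = -(r * s ^ 2 + 2 * a * r * s - q) / (2 * (a + s) ^ 2))
    (Jstar : ℝ) (hJstar : Jstar = a * r + r * Real.sqrt (a ^ 2 + q / r))
    (k₁0 k₂0 : EuclideanSpace ℝ (Fin κ))
    (hstab0 : a + ⟪k₂0, k₁0⟫ < 0)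
    (hinit : ‖k₁0 - k₂0‖ > 2 * Real.sqrt (max a 0)) :
    ∀ ε > (0 : ℝ), ∃ δ > (0 : ℝ),
      ∀ u₁ u₂ : ℝ → EuclideanSpace ℝ (Fin κ),
        (∃ M₁ M₂ : ℝ, (∀ t : ℝ, ‖u₁ t‖ ≤ M₁) ∧ (∀ t : ℝ, ‖u₂ t‖ ≤ M₂) ∧ M₁ + M₂ ≤ δ) →
        ∀ k₁ k₂ : ℝ → EuclideanSpace ℝ (Fin κ),
          k₁ 0 = k₁0 → k₂ 0 = k₂0 →
          (∀ t ∈ Ici (0 : ℝ), a + ⟪k₂ t, k₁ t⟫ < 0) →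
          (∀ t ∈ Ici (0 : ℝ),
            HasDerivWithinAt k₁ (-(fhat ⟪k₂ t, k₁ t⟫) • k₂ t + u₁ t) (Ici 0) t) →
          (∀ t ∈ Ici (0 : ℝ),
            HasDerivWithinAt k₂ (-(fhat ⟪k₂ t, k₁ t⟫) • k₁ t + u₂ t) (Ici 0) t) →
          limsup (fun t => J (k₁ t) (k₂ t) - Jstar) atTop ≤ ε := by
  intro ε hε
  set X : ℝ := Real.sqrt (a ^ 2 + q / r) with hXdef
  have hqr : 0 < q / r := div_pos hq hr
  have hX2 : X ^ 2 = a ^ 2 + q / r := Real.sq_sqrt (by positivity)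
  have hX : 0 < X := Real.sqrt_pos.2 (by positivity)
  have haX : |a| < X := abs_lt_of_sq_lt_sq (by linarith) hX.le
  obtain ⟨haX1, haX2⟩ := abs_lt.1 haX
  have hqX : q = r * (X ^ 2 - a ^ 2) := by rw [hX2]; field_simp; ring
  have hfx : ∀ s, a + s < 0 → fhat s = r / 2 * (X ^ 2 / (-a - s) ^ 2 - 1) := by
    intro s hs
    have h1 : a + s ≠ 0 := hs.ne
    have h2 : -a - s ≠ 0 := by linarith
    rw [hfhat, hqX, show (-a - s) ^ 2 = (a + s) ^ 2 by ring]
    field_simp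
    ring
  have hJx : ∀ v w, a + ⟪w, v⟫ < 0 →
      J v w - Jstar = r * ((-a - ⟪w, v⟫) - X) ^ 2 / (2 * (-a - ⟪w, v⟫)) := by
    intro v w hs
    have h1 : a + ⟪w, v⟫ ≠ 0 := hs.ne
    have h2 : -a - ⟪w, v⟫ ≠ 0 := by linarith
    rw [hJ, hqX, hJstar, show -a - ⟪w, v⟫ = -(a + ⟪w, v⟫) by ring]
    field_simp
    ring
  have hd0 : 0 < ‖k₁0 - k₂0‖ := lt_of_le_of_lt (by positivity) hinit
  set c : ℝ := min ‖k₁0 - k₂0‖ (Real.sqrt (2 * (a + X)))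
  have hc : 0 < c := lt_min hd0 (Real.sqrt_pos.2 (by linarith))
  have hc2 : c ^ 2 ≤ 2 * (a + X) :=
    (pow_le_pow_left₀ hc.le (min_le_right _ _) 2).trans_eq (Real.sq_sqrt (by linarith))
  set θ : ℝ := min (1 / 2) (ε / (r * X))
  have hθ : 0 < θ := lt_min (by norm_num) (by positivity)
  have hθ1 : θ ≤ 1 / 2 := min_le_left _ _
  have hθε : r * X * θ ≤ ε := by
    have : θ ≤ ε / (r * X) := min_le_right _ _
    rwa [le_div_iff₀ (by positivity), mul_comm] at this
  have hxl : 0 < X * (1 - θ) := mul_pos hX (by linarith)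
  have hηpos := lqr_rate_pos (X := X) (x := (X - a) / 2) hr (by linarith) (by linarith)
  have hlpos := lqr_rate_pos (X := X) (x := X * (1 - θ)) hr hxl (by nlinarith)
  have hhneg := lqr_rate_neg (X := X) (x := X * (1 + θ)) hr hX (by nlinarith)
  set η : ℝ := r / 2 * (X ^ 2 / ((X - a) / 2) ^ 2 - 1)
  set m : ℝ := min (r / 2 * (X ^ 2 / (X * (1 - θ)) ^ 2 - 1))
    (-(r / 2 * (X ^ 2 / (X * (1 + θ)) ^ 2 - 1)))
  have hm : 0 < m := lt_min hlpos (neg_pos.2 hhneg)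
  refine ⟨min (η * c / 2) (m * c / 4), lt_min (by positivity) (by positivity), ?_⟩
  rintro u₁ u₂ ⟨M₁, M₂, h₁, h₂, hM⟩ k₁ k₂ h10 h20 hstab hk₁ hk₂
  have hx : ∀ t, 0 ≤ t → 0 < -a - ⟪k₂ t, k₁ t⟫ := fun t ht => by linarith [hstab t ht]
  have hd : ∀ t, 0 ≤ t → c ≤ ‖k₁ t - k₂ t‖ := fun t ht => by
    refine le_norm_sub_of_disturbed_flow (F := fun t => fhat ⟪k₂ t, k₁ t⟫) (η := η) hc
      ((min_le_left _ _).trans_lt (half_lt_self (by positivity))) h₁ h₂ hM hk₁ hk₂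
      (by rw [h10, h20]; exact min_le_left _ _) (fun s hs hsc => ?_) ht
    have hle := neg_inner_le_norm_sub_sq_div_four (k₁ s) (k₂ s)
    rw [hsc] at hle
    rw [hfx _ (hstab s hs)]
    exact lqr_rate_antitone hr (hx s hs) (by linarith)
  have hmem := eventually_mem_Icc_of_disturbed_flow (F := fun t => fhat ⟪k₂ t, k₁ t⟫) (a := a)
    (xl := X * (1 - θ)) (xh := X * (1 + θ)) hc hm (min_le_right _ _) h₁ h₂ hM hk₁ hk₂ hd
    (fun t ht h => by
      rw [hfx _ (hstab t ht)]
      exact (min_le_left _ _).trans (lqr_rate_antitone hr (hx t ht) h))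
    (fun t ht h => by
      rw [hfx _ (hstab t ht)]
      have h1 := lqr_rate_antitone (X := X) hr (by nlinarith : 0 < X * (1 + θ)) h
      have h2 : m ≤ -(r / 2 * (X ^ 2 / (X * (1 + θ)) ^ 2 - 1)) := min_le_right _ _
      linarith)
  refine limsup_le_of_le (IsBoundedUnder.isCoboundedUnder_le ⟨0, ?_⟩) ?_
  · rw [eventually_map]
    filter_upwards [eventually_ge_atTop 0] with t ht
    have := hx t ht
    rw [hJx _ _ (hstab t ht)]
    positivity
  · filter_upwards [eventually_ge_atTop 0, hmem] with t ht hmt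
    have hxt := hx t ht
    rw [hJx _ _ (hstab t ht), div_le_iff₀ (by positivity)]
    obtain ⟨hl, hh⟩ := hmt
    set x : ℝ := -a - ⟪k₂ t, k₁ t⟫
    have hsq : (x - X) ^ 2 ≤ (X * θ) ^ 2 := sq_le_sq' (by linarith) (by linarith)
    have hxX : X ≤ 2 * x := by nlinarith
    calc r * (x - X) ^ 2 ≤ r * (X * θ) ^ 2 := by gcongr
      _ = r * X * θ * (θ * X) := by ring
      _ ≤ ε * (1 * (2 * x)) := by gcongr; linarith
      _ = ε * (2 * x) := by ring
end
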